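/- Under the Setup, in the construction of the Le diagram of W the necklace term I_n^W contributes a + in the (n−3) → n position, and the necklace term I_{n−1}^W contributes a + in the (n−3) → (n−1) position together with all of the plusses contributed by the term I_n^V in the Le diagram of V. -/

import Mathlib

open scoped Classical

namespace WLD

/-- A propagator of a Wilson loop diagram on the cyclically ordered vertex set
`ZMod n` (vertex `n` is identified with `0`): an unordered pair of edges, the
edge joining vertex `i` to vertex `i+1` being labelled `i`. -/
abbrev Prp (n : ℕ) := Sym2 (ZMod n)

variable (n : ℕ)

/-- The position of `x` in the linear order `i <_i i+1 <_i ⋯ <_i i-1`. -/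
def ord (i x : ZMod n) : ℕ := (x - i).val

/-- The other end of a propagator `p` having an end on the edge `e`. -/
noncomputable def otherEnd (p : Prp n) (e : ZMod n) : ZMod n :=
  if h : e ∈ p then Sym2.Mem.other h else e

/-- The vertex support `V(p) = {i, i+1, j, j+1}` of the propagator `p = (i,j)`. -/
def supp (p : Prp n) : Finset (ZMod n) :=
  Sym2.lift ⟨fun i j => {i, i + 1, j, j + 1}, fun i j => by
    ext x
    simp only [Finset.mem_insert, Finset.mem_singleton]
    tauto⟩ p

/-- The vertex support `V(Q)` of a set of propagators. -/
def suppSet (Q : Finset (Prp n)) : Finset (ZMod n) := Q.biUnion (supp n)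

/-- `Prop(U)`: the propagators of `P` supported on (a vertex of) `U`. -/
noncomputable def propsOn (P : Finset (Prp n)) (U : Finset (ZMod n)) : Finset (Prp n) :=
  P.filter fun p => (supp n p ∩ U).Nonempty

/-- Two propagators `p = (i,j)` and `q = (k,l)` cross if `i < k < j < l` cyclically. -/
def Crossing (p q : Prp n) : Prop :=
  ∃ i j k l : ZMod n, p = s(i, j) ∧ q = s(k, l) ∧
    0 < ord n i k ∧ ord n i k < ord n i j ∧ ord n i j < ord n i l

/-- Weak admissibility of a Wilson loop diagram. -/
structure IsWeaklyAdmissible (P : Finset (Prp n)) : Prop where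
  dense : ∀ Q ⊆ P, Q.Nonempty → Q.card + 3 ≤ (suppSet n Q).card
  noncross : ∀ p ∈ P, ∀ q ∈ P, ¬ Crossing n p q

/-- Admissibility of a Wilson loop diagram. -/
structure IsAdmissible (P : Finset (Prp n)) : Prop where
  card_add_four_le : P.card + 4 ≤ n
  dense : ∀ Q ⊆ P, Q.Nonempty → Q.card + 3 ≤ (suppSet n Q).card
  noncross : ∀ p ∈ P, ∀ q ∈ P, ¬ Crossing n p q

/-- The length of a propagator `p = (i,j)`:
`min(|[i+1, j]|, |[j+1, i]|)`, the number of vertices on its smaller side. -/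
def plength (p : Prp n) : ℕ :=
  Sym2.lift ⟨fun i j => min ((j - i - 1).val + 1) ((i - j - 1).val + 1),
    fun _ _ => min_comm _ _⟩ p

/-- `InsideDir n i p q` : the propagator `q = (k,l)` lies (weakly) inside the
propagator `p = (i,j)` directed from its end `i`, i.e. `i ≤_i k <_i l ≤_i j`. -/
def InsideDir (i : ZMod n) (p q : Prp n) : Prop :=
  ∃ j k l : ZMod n, p = s(i, j) ∧ q = s(k, l) ∧
    ord n i k < ord n i l ∧ ord n i l ≤ ord n i j

/-- Sorting key measuring how far clockwise of the vertex `a` the relevant end of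
a propagator supported on `a` is attached: ends on the edge `a-1` are clockwise of
ends on the edge `a`, and on a fixed edge an end is the more clockwise the larger
the propagator is (nestedness of noncrossing propagators sharing an edge). -/
noncomputable def cwKey (a : ZMod n) (p : Prp n) : ℕ :=
  if a - 1 ∈ p then n + ord n (a - 1) (otherEnd n p (a - 1))
  else ord n a (otherEnd n p a)

/-- The clockwise-most propagator of `S` supported on the vertex `a`, if any. -/
noncomputable def pickCW (S : Finset (Prp n)) (a : ZMod n) : Option (Prp n) :=
  if h : (S.filter fun p => a ∈ supp n p).Nonempty then
    some (Classical.choose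
      ((S.filter fun p => a ∈ supp n p).exists_max_image (cwKey n a) h))
  else none

/-- The Grassmann necklace algorithm started at the vertex `i`: after `t` steps,
`(gnRun n P i t).1` is the set of propagators not yet deleted, and
`(gnRun n P i t).2` records the vertex assigned to each deleted propagator.
Step `t+1` processes the vertex `i + t`: if some not-yet-deleted propagator is
supported on it, the clockwise-most such propagator is deleted and assigned
that vertex. -/
noncomputable def gnRun (P : Finset (Prp n)) (i : ZMod n) :
    ℕ → Finset (Prp n) × (Prp n → Option (ZMod n))
  | 0 => (P, fun _ => none)
  | t + 1 =>
    match pickCW n (gnRun P i t).1 (i + (t : ZMod n)) with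
    | none => gnRun P i t
    | some p => ((gnRun P i t).1.erase p,
        Function.update (gnRun P i t).2 p (some (i + (t : ZMod n))))

/-- `I_i^W(p)`: the vertex contributed by the propagator `p` to the Grassmann
necklace term `I_i^W` (as an `Option`; the algorithm makes one full circuit of
the vertex set, i.e. runs for `n` steps). -/
noncomputable def gnAssign (P : Finset (Prp n)) (i : ZMod n) (p : Prp n) :
    Option (ZMod n) :=
  (gnRun n P i n).2 p

/-- The Grassmann necklace term `I_i^W` produced by the algorithm. -/
noncomputable def gnSet [NeZero n] (P : Finset (Prp n)) (i : ZMod n) :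
    Finset (ZMod n) :=
  Finset.univ.filter fun v => ∃ p, gnAssign n P i p = some v

/-- The cyclic interval `{a, a+1, …, a + (len-1)}` in `ZMod n`. -/
def cInterval [NeZero n] (a : ZMod n) (len : ℕ) : Finset (ZMod n) :=
  Finset.univ.filter fun x => ord n a x < len

/-- A Grassmann necklace of type `(k, n)`: a cyclic sequence of `k`-element
subsets of the vertex set such that `I_{i+1} = (I_i \ {i}) ∪ {j}` for some `j`
whenever `i ∈ I_i`, and `I_{i+1} = I_i` otherwise. -/
def IsGrassmannNecklace [NeZero n] (k : ℕ) (I : ZMod n → Finset (ZMod n)) : Prop :=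
  (∀ i, (I i).card = k) ∧
  ∀ i : ZMod n,
    (i ∈ I i → ∃ j : ZMod n, I (i + 1) = insert j ((I i).erase i)) ∧
    (i ∉ I i → I (i + 1) = I i)

/-- Independence in the matroid `M(W)`: no subset `U` of `J` supports fewer
propagators than the vertices it contains. -/
def Indep (P : Finset (Prp n)) (J : Finset (ZMod n)) : Prop :=
  ∀ U ⊆ J, U.card ≤ (propsOn n P U).card

/-- `A` is lexicographically smaller than `B` with respect to the order `<_i`:
the `<_i`-least element of the symmetric difference lies in `A`. -/
def LexLt (i : ZMod n) (A B : Finset (ZMod n)) : Prop :=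
  ∃ v, v ∈ A ∧ v ∉ B ∧ ∀ w, ord n i w < ord n i v → (w ∈ A ↔ w ∈ B)

/-- A `+` is placed in the box `(a, b)` of the Le diagram with row labels `I₁`
by the necklace term `Ii`: writing `I₁ \ Ii = {a₁ > ⋯ > a_r}` and
`Ii \ I₁ = {b₁ < ⋯ < b_r}` in the `<₁` order, the plusses are in the boxes
`(a_t, b_t)`. -/
def LePlusAt (I₁ Ii : Finset (ZMod n)) (a b : ZMod n) : Prop :=
  a ∈ I₁ \ Ii ∧ b ∈ Ii \ I₁ ∧
    ((I₁ \ Ii).filter fun x => ord n 1 a < ord n 1 x).card =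
      ((Ii \ I₁).filter fun y => ord n 1 y < ord n 1 b).card

/-- The box `(a, b)` of the Le diagram of the diagram `P` contains a `+`. -/
def LePlus [NeZero n] (P : Finset (Prp n)) (a b : ZMod n) : Prop :=
  ∃ i : ZMod n, LePlusAt n (gnSet n P 1) (gnSet n P i) a b

/-- The number of `+` entries in the Le diagram of the diagram `P`. -/
noncomputable def plusCount [NeZero n] (P : Finset (Prp n)) : ℕ :=
  (Finset.univ.filter fun ab : ZMod n × ZMod n => LePlus n P ab.1 ab.2).card

/-- The length of the row labelled `a` of the Young diagram with row labels `I₁`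
(the boxes of row `a` are indexed by the column labels `b ∉ I₁` with `a <₁ b`). -/
noncomputable def rowLen [NeZero n] (I₁ : Finset (ZMod n)) (a : ZMod n) : ℕ :=
  (Finset.univ.filter fun b => b ∉ I₁ ∧ ord n 1 a < ord n 1 b).card

/-- The entry of the matrix `C(W)` in row `p` and column `q`: the indeterminate
`x_{p,q}` if `q ∈ V(p)`, and `0` otherwise. -/
noncomputable def CW (p : Prp n) (q : ZMod n) : MvPolynomial (Prp n × ZMod n) ℝ :=
  if q ∈ supp n p then MvPolynomial.X (p, q) else 0

/-- The column paired with the row `p` in the minors determined by `I_i^W`. -/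
noncomputable def colOf (P : Finset (Prp n)) (i : ZMod n) (p : Prp n) : ZMod n :=
  (gnAssign n P i p).getD i

/-- `Δ_{I_i}`: the determinant of the `k × k` minor of `C(W)` on the columns
indexed by `I_i^W`, rows and columns paired via the necklace assignment. -/
noncomputable def Delta (P : Finset (Prp n)) (i : ZMod n) :
    MvPolynomial (Prp n × ZMod n) ℝ :=
  Matrix.det (Matrix.of fun p q : ↥P => CW n (p : Prp n) (colOf n P i (q : Prp n)))

/-- `S_i`: the propagators whose contribution changes from `I_{i-1}` to `I_i`. -/
noncomputable def Schanged (P : Finset (Prp n)) (i : ZMod n) : Finset (Prp n) :=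
  P.filter fun p => gnAssign n P (i - 1) p ≠ gnAssign n P i p

/-- `r_i`: the determinant of the minor of `C(W)` with rows indexed by `S_i` and
columns indexed by `I_i(S_i)` (equal to `1` when `S_i = ∅`). -/
noncomputable def rfac (P : Finset (Prp n)) (i : ZMod n) :
    MvPolynomial (Prp n × ZMod n) ℝ :=
  Matrix.det
    (Matrix.of fun p q : ↥(Schanged n P i) => CW n (p : Prp n) (colOf n P i (q : Prp n)))

/-- `R = ∏ᵢ rᵢ`, the polynomial produced by the algorithm. -/
noncomputable def Rpoly [NeZero n] (P : Finset (Prp n)) :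
    MvPolynomial (Prp n × ZMod n) ℝ :=
  ∏ i : ZMod n, rfac n P i

/-- Position of the end of the propagator `p` along the edge `e`: larger values
attach closer to the vertex `e`, i.e. earlier in the counterclockwise ordering
of the ends of propagators along the edge `e`. -/
noncomputable def edgeKey (e : ZMod n) (p : Prp n) : ℕ := ord n e (otherEnd n p e)

/-- The propagators of `P` with an end on the edge `e`. -/
noncomputable def onEdge (P : Finset (Prp n)) (e : ZMod n) : Finset (Prp n) :=
  P.filter fun p => e ∈ p

/-- `p` is the first propagator (`p₁`) on the edge `e` in the counterclockwise
ordering of the propagators with an end on the edge `e`. -/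
def IsCcwFirst (P : Finset (Prp n)) (e : ZMod n) (p : Prp n) : Prop :=
  p ∈ onEdge n P e ∧ ∀ q ∈ onEdge n P e, edgeKey n e q ≤ edgeKey n e p

/-- `p` is the last propagator (`p_r`) on the edge `e` in the counterclockwise
ordering of the propagators with an end on the edge `e`. -/
def IsCcwLast (P : Finset (Prp n)) (e : ZMod n) (p : Prp n) : Prop :=
  p ∈ onEdge n P e ∧ ∀ q ∈ onEdge n P e, edgeKey n e p ≤ edgeKey n e q

/-- `p` and `q` are consecutive, in this order (`p = p_j`, `q = p_{j+1}`), in the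
counterclockwise ordering of the propagators with an end on the edge `e`. -/
def ConsecOnEdge (P : Finset (Prp n)) (e : ZMod n) (p q : Prp n) : Prop :=
  p ∈ onEdge n P e ∧ q ∈ onEdge n P e ∧ edgeKey n e q < edgeKey n e p ∧
    ∀ r ∈ onEdge n P e, ¬ (edgeKey n e q < edgeKey n e r ∧ edgeKey n e r < edgeKey n e p)

/-- The factor `R_e` of the denominator `R(W)` associated to the edge `e`:
`R_e = x_{p₁,e+1} • ∏_{j=1}^{r-1} (x_{p_j,e} x_{p_{j+1},e+1} - x_{p_{j+1},e} x_{p_j,e+1}) • x_{p_r,e}`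
for the counterclockwise ordering `p₁, …, p_r` of the propagators on the edge `e`
(`R_e = 1` if there are none). -/
noncomputable def Redge (P : Finset (Prp n)) (e : ZMod n) :
    MvPolynomial (Prp n × ZMod n) ℝ :=
  (∏ p ∈ (onEdge n P e).filter (IsCcwFirst n P e), MvPolynomial.X (p, e + 1)) *
    (∏ pq ∈ (P ×ˢ P).filter (fun pq => ConsecOnEdge n P e pq.1 pq.2),
      (MvPolynomial.X (pq.1, e) * MvPolynomial.X (pq.2, e + 1) -
        MvPolynomial.X (pq.2, e) * MvPolynomial.X (pq.1, e + 1))) *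
    (∏ p ∈ (onEdge n P e).filter (IsCcwLast n P e), MvPolynomial.X (p, e))

/-- The denominator `R(W) = ∏ₑ R_e` of the integrand `Ω(W)`. -/
noncomputable def RW [NeZero n] (P : Finset (Prp n)) :
    MvPolynomial (Prp n × ZMod n) ℝ :=
  ∏ e : ZMod n, Redge n P e

/-- The relabelling map associated to the removal of the vertex `i` from the
vertex set `ZMod n`: the vertex of `ZMod (n-1)` in position `t` (in the `<₁`
order) is sent to the vertex of `ZMod n` in position `t` if `t` precedes the
position of `i`, and to the vertex in position `t+1` otherwise. -/
noncomputable def liftVert (i : ZMod n) (x : ZMod (n - 1)) : ZMod n :=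
  1 + ((if ord (n - 1) 1 x < ord n 1 i then ord (n - 1) 1 x
        else ord (n - 1) 1 x + 1 : ℕ) : ZMod n)

end WLD
namespace WLD

/-- The diagram `V` of the Setup: the diagram `W` with the length-2 propagator
`p = (n-3, n-1)` removed. -/
noncomputable def eraseP (n : ℕ) (P : Finset (Prp n)) : Finset (Prp n) :=
  P.erase (s(-3, -1) : Prp n)

section Keys

variable {n : ℕ}

theorem otherEnd_mk (e x : ZMod n) : otherEnd n s(e, x) e = x := by
  unfold otherEnd
  rw [dif_pos (Sym2.mem_mk_left e x)]
  exact Sym2.congr_right.mp (Sym2.other_spec (Sym2.mem_mk_left e x))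

theorem mem_supp_iff (p : Prp n) (a : ZMod n) : a ∈ supp n p ↔ a - 1 ∈ p ∨ a ∈ p := by
  induction p using Sym2.ind with
  | _ i j =>
    simp only [supp, Sym2.lift_mk, Finset.mem_insert, Finset.mem_singleton, Sym2.mem_iff,
      sub_eq_iff_eq_add]
    tauto

theorem cwKey_of_mem_pred (a x : ZMod n) : cwKey n a s(a - 1, x) = n + ord n (a - 1) x := by
  unfold cwKey
  rw [if_pos (Sym2.mem_mk_left _ _), otherEnd_mk]

theorem cwKey_of_not_mem_pred (a x : ZMod n) (h : a - 1 ∉ (s(a, x) : Prp n)) :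
    cwKey n a s(a, x) = ord n a x := by
  unfold cwKey
  rw [if_neg h, otherEnd_mk]

theorem ord_lt [NeZero n] (i x : ZMod n) : ord n i x < n := ZMod.val_lt _

theorem ord_injective [NeZero n] (i x y : ZMod n) (h : ord n i x = ord n i y) : x = y :=
  sub_left_injective (ZMod.val_injective n h)

theorem cwKey_lt_of_not_mem_pred [NeZero n] (a : ZMod n) (p : Prp n) (h : a - 1 ∉ p) :
    cwKey n a p < n := by
  unfold cwKey
  rw [if_neg h]
  exact ord_lt _ _

theorem cwKey_inj [NeZero n] {a : ZMod n} {p q : Prp n} (hp : a ∈ supp n p)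
    (hq : a ∈ supp n q) (h : cwKey n a p = cwKey n a q) : p = q := by
  by_cases hpa : a - 1 ∈ p <;> by_cases hqa : a - 1 ∈ q
  · obtain ⟨x, rfl⟩ := hpa
    obtain ⟨y, rfl⟩ := hqa
    rw [cwKey_of_mem_pred, cwKey_of_mem_pred] at h
    rw [ord_injective (a - 1) x y (by omega)]
  · have := cwKey_lt_of_not_mem_pred a q hqa
    obtain ⟨x, rfl⟩ := hpa
    rw [cwKey_of_mem_pred] at h
    omega
  · have := cwKey_lt_of_not_mem_pred a p hpa
    obtain ⟨x, rfl⟩ := hqa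
    rw [cwKey_of_mem_pred] at h
    omega
  · obtain ⟨x, rfl⟩ := ((mem_supp_iff p a).1 hp).resolve_left hpa
    obtain ⟨y, rfl⟩ := ((mem_supp_iff q a).1 hq).resolve_left hqa
    rw [cwKey_of_not_mem_pred _ _ hpa, cwKey_of_not_mem_pred _ _ hqa] at h
    rw [ord_injective _ x y h]

theorem pickCW_eq_some_iff [NeZero n] (S : Finset (Prp n)) (a : ZMod n) (p : Prp n) :
    pickCW n S a = some p ↔
      p ∈ S ∧ a ∈ supp n p ∧ ∀ q ∈ S, a ∈ supp n q → cwKey n a q ≤ cwKey n a p := by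
  unfold pickCW
  split_ifs with h
  · have hc := Classical.choose_spec
      ((S.filter fun p => a ∈ supp n p).exists_max_image (cwKey n a) h)
    set c := Classical.choose
      ((S.filter fun p => a ∈ supp n p).exists_max_image (cwKey n a) h)
    obtain ⟨hc1, hc2⟩ := hc
    rw [Finset.mem_filter] at hc1
    have hmax : ∀ q ∈ S, a ∈ supp n q → cwKey n a q ≤ cwKey n a c :=
      fun q hq hqa => hc2 q (Finset.mem_filter.2 ⟨hq, hqa⟩)
    rw [Option.some_inj]
    constructor
    · rintro rfl
      exact ⟨hc1.1, hc1.2, hmax⟩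
    · rintro ⟨h1, h2, h3⟩
      exact cwKey_inj hc1.2 h2 (le_antisymm (h3 c hc1.1 hc1.2) (hmax p h1 h2))
  · simp only [false_iff]
    rintro ⟨h1, h2, -⟩
    exact h ⟨p, Finset.mem_filter.2 ⟨h1, h2⟩⟩

theorem pickCW_eq_none_iff (S : Finset (Prp n)) (a : ZMod n) :
    pickCW n S a = none ↔ ∀ p ∈ S, a ∉ supp n p := by
  unfold pickCW
  split_ifs with h
  · simp only [false_iff]
    obtain ⟨p, hp⟩ := h
    rw [Finset.mem_filter] at hp
    exact fun h => h p hp.1 hp.2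
  · simp only [true_iff]
    exact fun p h1 h2 => h ⟨p, Finset.mem_filter.2 ⟨h1, h2⟩⟩

end Keys

section Run

variable {n : ℕ}

/-- The propagators not yet deleted after `t` steps of the algorithm. -/
noncomputable def remaining (P : Finset (Prp n)) (i : ZMod n) (t : ℕ) : Finset (Prp n) :=
  (gnRun n P i t).1

/-- The propagator deleted in step `t + 1` of the algorithm, if any. -/
noncomputable def picked (P : Finset (Prp n)) (i : ZMod n) (t : ℕ) : Option (Prp n) :=
  pickCW n (remaining P i t) (i + (t : ZMod n))

theorem remaining_zero (P : Finset (Prp n)) (i : ZMod n) : remaining P i 0 = P := rfl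

theorem remaining_succ_of_none {P : Finset (Prp n)} {i : ZMod n} {t : ℕ}
    (h : picked P i t = none) : remaining P i (t + 1) = remaining P i t := by
  unfold picked remaining at *
  rw [gnRun]
  split <;> simp_all

theorem remaining_succ_of_some {P : Finset (Prp n)} {i : ZMod n} {t : ℕ} {p : Prp n}
    (h : picked P i t = some p) : remaining P i (t + 1) = (remaining P i t).erase p := by
  unfold picked remaining at *
  rw [gnRun]
  split <;> simp_all

theorem remaining_succ_subset (P : Finset (Prp n)) (i : ZMod n) (t : ℕ) :
    remaining P i (t + 1) ⊆ remaining P i t := by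
  cases h : picked P i t with
  | none => rw [remaining_succ_of_none h]
  | some p => rw [remaining_succ_of_some h]; exact Finset.erase_subset _ _

theorem remaining_antitone (P : Finset (Prp n)) (i : ZMod n) : Antitone (remaining P i) :=
  antitone_nat_of_succ_le (remaining_succ_subset P i)

theorem remaining_subset (P : Finset (Prp n)) (i : ZMod n) (t : ℕ) : remaining P i t ⊆ P :=
  remaining_antitone P i (Nat.zero_le t)

theorem gnRun_snd_eq_some_iff [NeZero n] (P : Finset (Prp n)) (i : ZMod n) (t : ℕ) (p : Prp n)
    (v : ZMod n) :
    (gnRun n P i t).2 p = some v ↔ ∃ u < t, v = i + (u : ZMod n) ∧ picked P i u = some p := by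
  induction t with
  | zero => simp [gnRun]
  | succ t ih =>
    cases h : picked P i t with
    | none =>
      have : (gnRun n P i (t + 1)).2 = (gnRun n P i t).2 := by
        unfold picked remaining at h
        rw [gnRun]
        split <;> simp_all
      rw [this, ih]
      constructor
      · rintro ⟨u, hu, h2⟩
        exact ⟨u, by omega, h2⟩
      · rintro ⟨u, hu, h2, h3⟩
        refine ⟨u, ?_, h2, h3⟩
        rcases Nat.lt_succ_iff_lt_or_eq.1 hu with h' | rfl
        · exact h'
        · simp [h] at h3
    | some c =>
      have : (gnRun n P i (t + 1)).2 =
          Function.update (gnRun n P i t).2 c (some (i + (t : ZMod n))) := by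
        unfold picked remaining at h
        rw [gnRun]
        split <;> simp_all
      rw [this]
      by_cases hpc : p = c
      · subst hpc
        rw [Function.update_self, Option.some_inj]
        constructor
        · rintro rfl
          exact ⟨t, by omega, rfl, h⟩
        · rintro ⟨u, hu, rfl, h3⟩
          rcases Nat.lt_succ_iff_lt_or_eq.1 hu with h' | rfl
          · have h4 := ((pickCW_eq_some_iff _ _ _).1 h).1
            have h5 := remaining_antitone P i (show u + 1 ≤ t from h') h4
            rw [remaining_succ_of_some h3] at h5
            simp at h5
          · rfl
      · rw [Function.update_of_ne hpc, ih]
        constructor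
        · rintro ⟨u, hu, h2⟩
          exact ⟨u, by omega, h2⟩
        · rintro ⟨u, hu, h2, h3⟩
          refine ⟨u, ?_, h2, h3⟩
          rcases Nat.lt_succ_iff_lt_or_eq.1 hu with h' | rfl
          · exact h'
          · rw [h, Option.some_inj] at h3
            exact absurd h3.symm hpc

theorem mem_gnSet_iff [NeZero n] (P : Finset (Prp n)) (i v : ZMod n) :
    v ∈ gnSet n P i ↔ ∃ t < n, v = i + (t : ZMod n) ∧ ∃ p, picked P i t = some p := by
  simp only [gnSet, gnAssign, Finset.mem_filter, Finset.mem_univ, true_and,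
    gnRun_snd_eq_some_iff]
  constructor
  · rintro ⟨p, t, h1, h2, h3⟩
    exact ⟨t, h1, h2, p, h3⟩
  · rintro ⟨t, h1, h2, p, h3⟩
    exact ⟨p, t, h1, h2, h3⟩

theorem picked_succ_of_remaining_eq {P Q : Finset (Prp n)} {i : ZMod n} {t : ℕ}
    (h : remaining P i (t + 1) = remaining Q (i + 1) t) :
    picked P i (t + 1) = picked Q (i + 1) t := by
  unfold picked
  rw [h, Nat.cast_succ, add_assoc, add_comm (1 : ZMod n)]

theorem remaining_succ_congr {P Q : Finset (Prp n)} {i j : ZMod n} {s t : ℕ}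
    (h : remaining P i s = remaining Q j t) (hp : picked P i s = picked Q j t) :
    remaining P i (s + 1) = remaining Q j (t + 1) := by
  cases h' : picked P i s with
  | none => rw [remaining_succ_of_none h', remaining_succ_of_none (hp ▸ h'), h]
  | some c => rw [remaining_succ_of_some h', remaining_succ_of_some (hp ▸ h'), h]

theorem remaining_shift {P Q : Finset (Prp n)} {i : ZMod n} (h : remaining P i 1 = Q) (t : ℕ) :
    remaining P i (t + 1) = remaining Q (i + 1) t := by
  induction t with
  | zero => exact h
  | succ t ih => exact remaining_succ_congr ih (picked_succ_of_remaining_eq ih)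

theorem picked_shift {P Q : Finset (Prp n)} {i : ZMod n} (h : remaining P i 1 = Q) (t : ℕ) :
    picked P i (t + 1) = picked Q (i + 1) t :=
  picked_succ_of_remaining_eq (remaining_shift h t)

theorem picked_eq_none_of_remaining_eq_empty {P : Finset (Prp n)} {i : ZMod n} {t : ℕ}
    (h : remaining P i t = ∅) : picked P i t = none := by
  unfold picked
  rw [h, pickCW_eq_none_iff]
  simp

theorem remaining_eq_empty_of_le {P : Finset (Prp n)} {i : ZMod n} {s t : ℕ}
    (h : remaining P i s = ∅) (hst : s ≤ t) : remaining P i t = ∅ :=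
  Finset.subset_empty.1 (h ▸ remaining_antitone P i hst)

theorem remaining_erase_cases [NeZero n] (P : Finset (Prp n)) (r : Prp n) (i : ZMod n) (t : ℕ) :
    remaining (P.erase r) i t = remaining P i t ∨
      ∃ c ∈ remaining P i t, remaining (P.erase r) i t = (remaining P i t).erase c := by
  induction t with
  | zero =>
    by_cases hr : r ∈ P
    · exact Or.inr ⟨r, hr, rfl⟩
    · exact Or.inl (Finset.erase_eq_of_notMem hr)
  | succ t ih =>
    rcases ih with h | ⟨c, hc, h⟩
    · left
      refine remaining_succ_congr h ?_
      unfold picked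
      rw [h]
    · cases hp : picked P i t with
      | none =>
        right
        refine ⟨c, by rwa [remaining_succ_of_none hp], ?_⟩
        rw [remaining_succ_of_none hp, remaining_succ_of_none, h]
        unfold picked at hp ⊢
        rw [pickCW_eq_none_iff] at hp ⊢
        rw [h]
        exact fun p hp' => hp p (Finset.mem_of_mem_erase hp')
      | some d =>
        have hp' := hp
        unfold picked at hp'
        rw [pickCW_eq_some_iff] at hp'
        by_cases hdc : d = c
        · subst hdc
          cases he : picked (P.erase r) i t with
          | none =>
            left
            rw [remaining_succ_of_none he, remaining_succ_of_some hp, h]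
          | some e =>
            right
            refine ⟨e, ?_, by rw [remaining_succ_of_some he, remaining_succ_of_some hp, h]⟩
            rw [remaining_succ_of_some hp, ← h]
            exact ((pickCW_eq_some_iff _ _ _).1 he).1
        · right
          refine ⟨c, ?_, ?_⟩
          · rw [remaining_succ_of_some hp]
            exact Finset.mem_erase.2 ⟨Ne.symm hdc, hc⟩
          · have he : picked (P.erase r) i t = some d := by
              unfold picked
              rw [pickCW_eq_some_iff, h]
              exact ⟨Finset.mem_erase.2 ⟨hdc, hp'.1⟩, hp'.2.1,
                fun q hq => hp'.2.2 q (Finset.mem_of_mem_erase hq)⟩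
            rw [remaining_succ_of_some hp, remaining_succ_of_some he, h,
              Finset.erase_right_comm]

theorem picked_of_picked_erase [NeZero n] {P : Finset (Prp n)} {r : Prp n} {i : ZMod n} {t : ℕ}
    (h : ∃ p, picked (P.erase r) i t = some p) : ∃ p, picked P i t = some p := by
  rw [← Option.ne_none_iff_exists'] at h ⊢
  refine fun h' => h ?_
  unfold picked at h' ⊢
  rw [pickCW_eq_none_iff] at h' ⊢
  rcases remaining_erase_cases P r i t with h2 | ⟨c, -, h2⟩
  · rwa [h2]
  · rw [h2]
    exact fun p hp => h' p (Finset.mem_of_mem_erase hp)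

/-- Starting one vertex earlier only adds that vertex to the necklace term. -/
theorem gnSet_subset_insert [NeZero n] (P : Finset (Prp n)) (i : ZMod n) :
    gnSet n P i ⊆ insert i (gnSet n P (i + 1)) := by
  intro v hv
  obtain ⟨t, ht, rfl, hp⟩ := (mem_gnSet_iff _ _ _).1 hv
  rw [Finset.mem_insert]
  cases t with
  | zero => simp
  | succ t =>
    right
    refine (mem_gnSet_iff _ _ _).2 ⟨t, by omega, by push_cast; ring, ?_⟩
    cases h : picked P i 0 with
    | none =>
      rw [picked_shift (remaining_succ_of_none h)] at hp
      exact hp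
    | some c =>
      rw [picked_shift (remaining_succ_of_some h)] at hp
      exact picked_of_picked_erase hp

/-- A propagator that survives a step in which it could have been deleted was outranked. -/
theorem exists_outranking [NeZero n] {P : Finset (Prp n)} {i : ZMod n} {t : ℕ} {r : Prp n}
    (hr : r ∈ remaining P i (t + 1)) (ha : i + (t : ZMod n) ∈ supp n r) :
    ∃ c ∈ remaining P i t, i + (t : ZMod n) ∈ supp n c ∧
      cwKey n (i + (t : ZMod n)) r < cwKey n (i + (t : ZMod n)) c := by
  have hr' := remaining_succ_subset P i t hr
  cases h : picked P i t with
  | none => exact absurd ha ((pickCW_eq_none_iff _ _).1 h r hr')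
  | some c =>
    rw [remaining_succ_of_some h] at hr
    obtain ⟨h1, h2, h3⟩ := (pickCW_eq_some_iff _ _ _).1 h
    refine ⟨c, h1, h2, lt_of_le_of_ne (h3 r hr' ha) fun he => ?_⟩
    rw [cwKey_inj ha h2 he] at hr
    exact Finset.notMem_erase _ _ hr

theorem remaining_erase_of_not_mem_supp [NeZero n] {P : Finset (Prp n)} {i : ZMod n} {p : Prp n}
    {T : ℕ} (hp : p ∈ P) (h : ∀ t < T, i + (t : ZMod n) ∉ supp n p) :
    ∀ t ≤ T, remaining P i t = insert p (remaining (P.erase p) i t) ∧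
      (t < T → picked P i t = picked (P.erase p) i t) := by
  have key : ∀ t < T, remaining P i t = insert p (remaining (P.erase p) i t) →
      picked P i t = picked (P.erase p) i t := by
    intro t ht hr
    have hpt := h t ht
    cases hc : picked (P.erase p) i t with
    | none =>
      unfold picked at hc ⊢
      rw [pickCW_eq_none_iff] at hc ⊢
      rw [hr]
      intro q hq
      rcases Finset.mem_insert.1 hq with rfl | hq
      exacts [hpt, hc q hq]
    | some c =>
      unfold picked at hc ⊢
      rw [pickCW_eq_some_iff] at hc ⊢
      rw [hr]
      refine ⟨Finset.mem_insert_of_mem hc.1, hc.2.1, fun q hq hqs => ?_⟩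
      rcases Finset.mem_insert.1 hq with rfl | hq
      exacts [absurd hqs hpt, hc.2.2 q hq hqs]
  intro t
  induction t with
  | zero =>
    intro _
    have h0 : remaining P i 0 = insert p (remaining (P.erase p) i 0) :=
      (Finset.insert_erase hp).symm
    exact ⟨h0, fun ht => key 0 ht h0⟩
  | succ t ih =>
    intro ht
    obtain ⟨h1, h2⟩ := ih (by omega)
    replace h2 := h2 (by omega)
    have h3 : remaining P i (t + 1) = insert p (remaining (P.erase p) i (t + 1)) := by
      cases hc : picked P i t with
      | none => rw [remaining_succ_of_none hc, remaining_succ_of_none (h2 ▸ hc), h1]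
      | some c =>
        rw [remaining_succ_of_some hc, remaining_succ_of_some (h2 ▸ hc), h1,
          Finset.erase_insert_of_ne]
        rintro rfl
        exact h t (by omega) ((pickCW_eq_some_iff _ _ _).1 hc).2.1
    exact ⟨h3, fun ht => key _ ht h3⟩

end Run

section Nat

variable {n : ℕ}

theorem natCast_inj_of_lt {a b : ℕ} (ha : a < n) (hb : b < n)
    (h : (a : ZMod n) = (b : ZMod n)) : a = b := by
  have := congrArg ZMod.val h
  rwa [ZMod.val_cast_of_lt ha, ZMod.val_cast_of_lt hb] at this

theorem ord_natCast_of_le {a b : ℕ} (hab : a ≤ b) (hb : b < n) :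
    ord n (a : ZMod n) (b : ZMod n) = b - a := by
  unfold ord
  rw [← Nat.cast_sub hab, ZMod.val_cast_of_lt (by omega)]

theorem ord_natCast_of_lt {a b : ℕ} (hba : b < a) (ha : a < n) :
    ord n (a : ZMod n) (b : ZMod n) = n + b - a := by
  unfold ord
  have : (b : ZMod n) - (a : ZMod n) = ((n + b - a : ℕ) : ZMod n) := by
    rw [Nat.cast_sub (by omega)]
    simp
  rw [this, ZMod.val_cast_of_lt (by omega)]

theorem neg_natCast_eq {k : ℕ} (hk : k ≤ n) : -(k : ZMod n) = ((n - k : ℕ) : ZMod n) := by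
  rw [Nat.cast_sub hk]
  simp

/-- Every propagator of `P` has length at least two. -/
def Long (P : Finset (Prp n)) : Prop :=
  ∀ r ∈ P, ∃ i j : ℕ, i + 2 ≤ j ∧ j < n ∧ j + 2 ≤ n + i ∧ r = s((i : ZMod n), (j : ZMod n))

/-- No two propagators of `P` cross. -/
def Planar (P : Finset (Prp n)) : Prop :=
  ∀ i j k l : ℕ, i < k → k < j → j < l → l < n →
    (s((i : ZMod n), (j : ZMod n)) : Prp n) ∈ P →
      (s((k : ZMod n), (l : ZMod n)) : Prp n) ∉ P

theorem IsAdmissible.planar {P : Finset (Prp n)} (h : IsAdmissible n P) : Planar P := by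
  intro i j k l h1 h2 h3 h4 hp hq
  refine h.noncross _ hp _ hq ⟨_, _, _, _, rfl, rfl, ?_⟩
  rw [ord_natCast_of_le (by omega) (by omega), ord_natCast_of_le (by omega) (by omega),
    ord_natCast_of_le (by omega) (by omega)]
  omega

theorem IsAdmissible.long [NeZero n] {P : Finset (Prp n)} (h : IsAdmissible n P) : Long P := by
  intro r hr
  have hcard : 4 ≤ (supp n r).card := by
    have := h.dense {r} (by simpa using hr) (by simp)
    simpa [suppSet] using this
  have key : ∀ i j : ℕ, i ≤ j → j < n → r = s((i : ZMod n), (j : ZMod n)) →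
      i + 2 ≤ j ∧ j < n ∧ j + 2 ≤ n + i := by
    intro i j hij hj hrij
    subst hrij
    simp only [supp, Sym2.lift_mk] at hcard
    refine ⟨?_, hj, ?_⟩
    · by_contra hlt
      have : j = i ∨ j = i + 1 := by omega
      have h3 : ({(i : ZMod n), (i : ZMod n) + 1, (j : ZMod n), (j : ZMod n) + 1} :
          Finset (ZMod n)) ⊆ {(i : ZMod n), (i : ZMod n) + 1, (i : ZMod n) + 1 + 1} := by
        rcases this with rfl | rfl <;> 
        (intro x; simp only [Finset.mem_insert, Finset.mem_singleton, Nat.cast_succ]; tauto)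
      have h4 := (Finset.card_le_card h3).trans Finset.card_le_three
      omega
    · by_contra hlt
      have hi : i = 0 := by omega
      have hj' : j + 1 = n := by omega
      have hj0 : (j : ZMod n) + 1 = 0 := by
        rw [← Nat.cast_succ, Nat.succ_eq_add_one, hj', ZMod.natCast_self]
      have h3 : ({(i : ZMod n), (i : ZMod n) + 1, (j : ZMod n), (j : ZMod n) + 1} :
          Finset (ZMod n)) ⊆ {(0 : ZMod n), 1, (j : ZMod n)} := by
        rw [hj0, hi]
        intro x
        simp
        tauto
      have h4 := (Finset.card_le_card h3).trans Finset.card_le_three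
      omega
  induction r using Sym2.ind with
  | _ a b =>
    have ha : ((a.val : ℕ) : ZMod n) = a := ZMod.natCast_zmod_val a
    have hb : ((b.val : ℕ) : ZMod n) = b := ZMod.natCast_zmod_val b
    rcases le_total a.val b.val with hab | hab
    · have hs : (s(a, b) : Prp n) = s((a.val : ZMod n), (b.val : ZMod n)) := by rw [ha, hb]
      obtain ⟨h1, h2, h3⟩ := key _ _ hab (ZMod.val_lt b) hs
      exact ⟨_, _, h1, h2, h3, hs⟩
    · have hs : (s(a, b) : Prp n) = s((b.val : ZMod n), (a.val : ZMod n)) := by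
        rw [ha, hb, Sym2.eq_swap]
      obtain ⟨h1, h2, h3⟩ := key _ _ hab (ZMod.val_lt a) hs
      exact ⟨_, _, h1, h2, h3, hs⟩

theorem Long.lt_of_mem [NeZero n] {P : Finset (Prp n)} (hP : Long P) {i j : ℕ} (hij : i < j)
    (hj : j < n) (h : (s((i : ZMod n), (j : ZMod n)) : Prp n) ∈ P) :
    i + 2 ≤ j ∧ j + 2 ≤ n + i := by
  obtain ⟨a, b, h1, h2, h3, h4⟩ := hP _ h
  rcases Sym2.eq_iff.1 h4 with ⟨h5, h6⟩ | ⟨h5, h6⟩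
  · have := natCast_inj_of_lt (by omega) (by omega) h5
    have := natCast_inj_of_lt (by omega) (by omega) h6
    omega
  · have := natCast_inj_of_lt (by omega) (by omega) h5
    have := natCast_inj_of_lt (by omega) (by omega) h6
    omega

theorem Long.cases_of_mem {P : Finset (Prp n)} (hP : Long P) {e : ℕ} (he : e < n)
    {r : Prp n} (hr : r ∈ P) (her : (e : ZMod n) ∈ r) :
    (∃ y, e < y ∧ y < n ∧ r = s((e : ZMod n), (y : ZMod n))) ∨
      ∃ x, x < e ∧ r = s((x : ZMod n), (e : ZMod n)) := by
  obtain ⟨i, j, h1, h2, h3, rfl⟩ := hP r hr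
  rcases Sym2.mem_iff.1 her with h | h
  · obtain rfl := natCast_inj_of_lt (by omega) (by omega) h
    exact Or.inl ⟨j, by omega, h2, rfl⟩
  · obtain rfl := natCast_inj_of_lt (by omega) (by omega) h
    exact Or.inr ⟨i, by omega, rfl⟩

theorem Long.subset {P Q : Finset (Prp n)} (hP : Long P) (h : Q ⊆ P) : Long Q :=
  fun r hr => hP r (h hr)

theorem Planar.subset {P Q : Finset (Prp n)} (hP : Planar P) (h : Q ⊆ P) : Planar Q :=
  fun i j k l h1 h2 h3 h4 hp hq => hP i j k l h1 h2 h3 h4 (h hp) (h hq)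

theorem natCast_not_mem {e i j : ℕ} (he : e < n) (hi : i < n) (hj : j < n) (hei : e ≠ i)
    (hej : e ≠ j) : (e : ZMod n) ∉ (s((i : ZMod n), (j : ZMod n)) : Prp n) := by
  rw [Sym2.mem_iff]
  rintro (h | h)
  · exact hei (natCast_inj_of_lt he hi h)
  · exact hej (natCast_inj_of_lt he hj h)

theorem cwKey_succ_of_lt {e y : ℕ} (hey : e < y) (hy : y < n) :
    cwKey n ((e + 1 : ℕ) : ZMod n) s((e : ZMod n), (y : ZMod n)) = n + (y - e) := by
  have h : (e : ZMod n) = ((e + 1 : ℕ) : ZMod n) - 1 := by simp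
  have h2 := cwKey_of_mem_pred ((e + 1 : ℕ) : ZMod n) (y : ZMod n)
  rwa [← h, ord_natCast_of_le hey.le hy] at h2

theorem cwKey_left {e y : ℕ} (he : 1 ≤ e) (hey : e < y) (hy : y < n) :
    cwKey n (e : ZMod n) s((e : ZMod n), (y : ZMod n)) = y - e := by
  rw [cwKey_of_not_mem_pred, ord_natCast_of_le hey.le hy]
  rw [← Nat.cast_pred (by omega)]
  exact natCast_not_mem (by omega) (by omega) hy (by omega) (by omega)

theorem cwKey_right {e x : ℕ} (hx : x + 2 ≤ e) (he : e < n) :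
    cwKey n (e : ZMod n) s((x : ZMod n), (e : ZMod n)) = n + x - e := by
  rw [Sym2.eq_swap, cwKey_of_not_mem_pred, ord_natCast_of_lt (by omega) he]
  rw [← Nat.cast_pred (by omega)]
  exact natCast_not_mem (by omega) (by omega) (by omega) (by omega) (by omega)

end Nat

section Greedy

variable {n : ℕ} [NeZero n]

theorem exists_outranking_of_left_succ {P : Finset (Prp n)} (hP : Long P) {i j : ℕ}
    (hij : i < j) (hj : j < n)
    (hr : (s((i : ZMod n), (j : ZMod n)) : Prp n) ∈ remaining P 1 (i + 1)) :
    ∃ c ∈ remaining P 1 i,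
      ((∃ y, j < y ∧ y < n ∧ c = s((i : ZMod n), (y : ZMod n))) ∨
        ∃ x, x < i ∧ c = s((x : ZMod n), (i : ZMod n))) := by
  have hv : (1 : ZMod n) + (i : ZMod n) = ((i + 1 : ℕ) : ZMod n) := by push_cast; ring
  have hv' : ((i + 1 : ℕ) : ZMod n) - 1 = (i : ZMod n) := by simp
  obtain ⟨c, h1, h3, h4⟩ := exists_outranking hr (by
    rw [hv, mem_supp_iff, hv']
    exact Or.inl (Sym2.mem_mk_left _ _))
  refine ⟨c, h1, ?_⟩
  rw [hv, cwKey_succ_of_lt hij hj] at h4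
  have hic : (i : ZMod n) ∈ c := by
    rw [← hv']
    by_contra hn
    have := cwKey_lt_of_not_mem_pred _ _ hn
    omega
  rcases hP.cases_of_mem (by omega) (remaining_subset _ _ _ h1) hic with
    ⟨y, hy1, hy2, rfl⟩ | hx
  · rw [cwKey_succ_of_lt hy1 hy2] at h4
    exact Or.inl ⟨y, by omega, hy2, rfl⟩
  · exact Or.inr hx

theorem exists_outranking_of_left {P : Finset (Prp n)} (hP : Long P) {i j : ℕ}
    (hij : i + 1 < j) (hj : j < n)
    (hr : (s(((i + 1 : ℕ) : ZMod n), (j : ZMod n)) : Prp n) ∈ remaining P 1 (i + 1)) :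
    ∃ c ∈ remaining P 1 i,
      ((∃ y, i < y ∧ y < n ∧ c = s((i : ZMod n), (y : ZMod n))) ∨
        (∃ x, x < i ∧ c = s((x : ZMod n), (i : ZMod n))) ∨
        (∃ y, j < y ∧ y < n ∧ c = s(((i + 1 : ℕ) : ZMod n), (y : ZMod n))) ∨
        ∃ x, x < i + 1 ∧ c = s((x : ZMod n), ((i + 1 : ℕ) : ZMod n))) := by
  have hv : (1 : ZMod n) + (i : ZMod n) = ((i + 1 : ℕ) : ZMod n) := by push_cast; ring
  have hv' : ((i + 1 : ℕ) : ZMod n) - 1 = (i : ZMod n) := by simp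
  obtain ⟨c, h1, h3, h4⟩ := exists_outranking hr (by
    rw [hv, mem_supp_iff]
    exact Or.inr (Sym2.mem_mk_left _ _))
  refine ⟨c, h1, ?_⟩
  rw [hv, cwKey_left (by omega) hij hj] at h4
  rw [hv, mem_supp_iff, hv'] at h3
  rcases h3 with hic | hic
  · rcases hP.cases_of_mem (by omega) (remaining_subset _ _ _ h1) hic with hy | hx
    · exact Or.inl hy
    · exact Or.inr (Or.inl hx)
  · rcases hP.cases_of_mem (by omega) (remaining_subset _ _ _ h1) hic with
      ⟨y, hy1, hy2, rfl⟩ | hx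
    · rw [cwKey_left (by omega) hy1 hy2] at h4
      exact Or.inr (Or.inr (Or.inl ⟨y, by omega, hy2, rfl⟩))
    · exact Or.inr (Or.inr (Or.inr hx))

theorem exists_outranking_of_right {P : Finset (Prp n)} (hP : Long P) {i j : ℕ}
    (hij : i + 2 ≤ j + 1) (hj : j + 1 < n)
    (hr : (s((i : ZMod n), ((j + 1 : ℕ) : ZMod n)) : Prp n) ∈ remaining P 1 (j + 1)) :
    ∃ c ∈ remaining P 1 j,
      ((∃ y, j < y ∧ y < n ∧ c = s((j : ZMod n), (y : ZMod n))) ∨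
        (∃ x, x < j ∧ c = s((x : ZMod n), (j : ZMod n))) ∨
        ∃ x, i < x ∧ x < j + 1 ∧ c = s((x : ZMod n), ((j + 1 : ℕ) : ZMod n))) := by
  have hv : (1 : ZMod n) + (j : ZMod n) = ((j + 1 : ℕ) : ZMod n) := by push_cast; ring
  have hv' : ((j + 1 : ℕ) : ZMod n) - 1 = (j : ZMod n) := by simp
  obtain ⟨c, h1, h3, h4⟩ := exists_outranking hr (by
    rw [hv, mem_supp_iff]
    exact Or.inr (Sym2.mem_mk_right _ _))
  refine ⟨c, h1, ?_⟩
  rw [hv, cwKey_right (by omega) hj] at h4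
  rw [hv, mem_supp_iff, hv'] at h3
  rcases h3 with hic | hic
  · rcases hP.cases_of_mem (by omega) (remaining_subset _ _ _ h1) hic with hy | hx
    · exact Or.inl hy
    · exact Or.inr (Or.inl hx)
  · rcases hP.cases_of_mem (by omega) (remaining_subset _ _ _ h1) hic with
      ⟨y, hy1, hy2, rfl⟩ | ⟨x, hx1, rfl⟩
    · rw [cwKey_left (by omega) hy1 hy2] at h4
      omega
    · have hl := hP.lt_of_mem hx1 hj (remaining_subset _ _ _ h1)
      rw [cwKey_right (by omega) hj] at h4
      exact Or.inr (Or.inr ⟨x, by omega, hx1, rfl⟩)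

/-- Starting at vertex `1`, the propagator `(i, j)`, `i < j`, is deleted by vertex `j`. -/
theorem not_mem_remaining_right {P : Finset (Prp n)} (hP : Long P) (hX : Planar P) (j : ℕ) :
    ∀ i, i < j → j < n → (s((i : ZMod n), (j : ZMod n)) : Prp n) ∉ remaining P 1 j := by
  induction j using Nat.strong_induction_on with
  | _ j ih =>
    intro i hij hj hr
    have hrP := remaining_subset _ _ _ hr
    have hl := hP.lt_of_mem hij hj hrP
    obtain ⟨j, rfl⟩ : ∃ j', j = j' + 1 := ⟨j - 1, by omega⟩
    obtain ⟨c, hc, ⟨y, hy1, hy2, rfl⟩ | ⟨x, hx, rfl⟩ | ⟨x, hx1, hx2, rfl⟩⟩ :=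
      exists_outranking_of_right hP (by omega) hj hr
    · have hcP := remaining_subset _ _ _ hc
      have := hP.lt_of_mem hy1 hy2 hcP
      exact hX i (j + 1) j y (by omega) (by omega) (by omega) hy2 hrP hcP
    · exact ih j (by omega) x hx (by omega) hc
    · have hcP := remaining_subset _ _ _ hc
      have := hP.lt_of_mem hx2 hj hcP
      obtain ⟨d, hd, ⟨y, hy1, hy2, rfl⟩ | ⟨z, hz, rfl⟩⟩ :=
        exists_outranking_of_left_succ hP hx2 hj
          (remaining_antitone P 1 (by omega : x + 1 ≤ j) hc)
      · exact hX i (j + 1) x y hx1 hx2 hy1 hy2 hrP (remaining_subset _ _ _ hd)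
      · exact ih x hx2 z hz (by omega) hd

/-- Starting at vertex `1`, the propagator `(i, n - 1)` is deleted by vertex `i`. -/
theorem not_mem_remaining_left {P : Finset (Prp n)} (hP : Long P) (hX : Planar P) (m : ℕ)
    (hm : m + 1 = n) (i : ℕ) :
    i < m → (s((i : ZMod n), (m : ZMod n)) : Prp n) ∉ remaining P 1 i := by
  induction i using Nat.strong_induction_on with
  | _ i ih =>
    intro hi hr
    have hrP := remaining_subset _ _ _ hr
    have hl := hP.lt_of_mem hi (by omega) hrP
    obtain ⟨i, rfl⟩ : ∃ i', i = i' + 1 := ⟨i - 1, by omega⟩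
    obtain ⟨c, hc, ⟨y, hy1, hy2, rfl⟩ | ⟨x, hx, rfl⟩ | ⟨y, hy1, hy2, rfl⟩ |
        ⟨x, hx, rfl⟩⟩ := exists_outranking_of_left hP hi (by omega) hr
    · have hcP := remaining_subset _ _ _ hc
      have := hP.lt_of_mem hy1 hy2 hcP
      rcases (by omega : y < m ∨ y = m) with hym | rfl
      · exact hX i y (i + 1) m (by omega) (by omega) hym (by omega) hcP hrP
      · exact ih i (by omega) (by omega) hc
    · exact not_mem_remaining_right hP hX i x hx (by omega) hc
    · omega
    · have hcP := remaining_subset _ _ _ hc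
      have := hP.lt_of_mem hx (by omega) hcP
      obtain ⟨d, hd, ⟨y, hy1, hy2, rfl⟩ | ⟨z, hz, rfl⟩⟩ :=
        exists_outranking_of_left_succ hP hx (by omega)
          (remaining_antitone P 1 (by omega : x + 1 ≤ i) hc)
      · have hdP := remaining_subset _ _ _ hd
        rcases (by omega : y < m ∨ y = m) with hym | rfl
        · exact hX x y (i + 1) m (by omega) (by omega) hym (by omega) hdP hrP
        · exact ih x (by omega) (by omega) hd
      · exact not_mem_remaining_right hP hX x z hz (by omega) hd

end Greedy

section Setup

variable {m : ℕ}

/-- Starting at vertex `1`, all propagators of `V` are deleted by vertex `n - 4`. -/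
theorem remaining_erase_eq_empty {P : Finset (Prp (m + 4))} (hP : Long P) (hX : Planar P)
    {p : Prp (m + 4)}
    (hpe : p = s(((m + 1 : ℕ) : ZMod (m + 4)), ((m + 3 : ℕ) : ZMod (m + 4)))) (hp : p ∈ P)
    (hedge : ∀ r ∈ P, ((m + 1 : ℕ) : ZMod (m + 4)) ∈ r → r = p ∨
      ∃ e, e + 1 = m ∧ r = s((e : ZMod (m + 4)), ((m + 1 : ℕ) : ZMod (m + 4)))) :
    remaining (P.erase p) 1 m = ∅ := by
  have hsub : P.erase p ⊆ P := Finset.erase_subset _ _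
  have hV := hP.subset hsub
  have hY := hX.subset hsub
  rw [Finset.eq_empty_iff_forall_notMem]
  intro r hr
  have hrV := remaining_subset _ _ _ hr
  have hrP := hsub hrV
  have hrp : r ≠ p := Finset.ne_of_mem_erase hrV
  obtain ⟨i, j, h1, h2, h3, rfl⟩ := hV r hrV
  rcases (by omega : j ≤ m ∨ j = m + 1 ∨ j = m + 2 ∨ j = m + 3) with hj | rfl | rfl | rfl
  · exact not_mem_remaining_right hV hY j i (by omega) h2 (remaining_antitone _ _ hj hr)
  · rcases hedge _ hrP (Sym2.mem_mk_right _ _) with h | ⟨e, rfl, h⟩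
    · exact hrp h
    · rw [h] at hr
      obtain ⟨c, hc, ⟨y, hy1, hy2, rfl⟩ | ⟨x, hx, rfl⟩⟩ :=
        exists_outranking_of_left_succ hV (by omega) h2 hr
      · have hcV := remaining_subset _ _ _ hc
        rcases (by omega : y = e + 1 + 2 ∨ y = e + 1 + 3) with rfl | rfl
        · exact hX e (e + 1 + 2) (e + 1 + 1) (e + 1 + 3) (by omega) (by omega) (by omega)
            (by omega) (hsub hcV) (hpe ▸ hp)
        · exact not_mem_remaining_left hV hY (e + 1 + 3) rfl e (by omega) hc
      · exact not_mem_remaining_right hV hY e x hx (by omega) hc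
  · exact hX i (m + 2) (m + 1) (m + 3) (by omega) (by omega) (by omega) (by omega) hrP
      (hpe ▸ hp)
  · rcases (by omega : i = m + 1 ∨ i ≤ m) with rfl | hi
    · exact hrp hpe.symm
    · exact not_mem_remaining_left hV hY (m + 3) rfl i (by omega)
        (remaining_antitone _ _ hi hr)

/-- A propagator other than `p` on the edge `n - 1` is shorter than `p` seen from there. -/
theorem ord_last_le {P : Finset (Prp (m + 4))} (hP : Long P) {x : ZMod (m + 4)}
    (h : s(((m + 3 : ℕ) : ZMod (m + 4)), x) ∈ P) :
    ord (m + 4) ((m + 3 : ℕ) : ZMod (m + 4)) x ≤ m + 2 := by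
  have hx : ((x.val : ℕ) : ZMod (m + 4)) = x := ZMod.natCast_zmod_val x
  have hlt := ZMod.val_lt x
  rw [← hx] at h ⊢
  rcases (by omega : x.val = m + 3 ∨ x.val < m + 3) with he | hl
  · rw [he, ord_natCast_of_le le_rfl (by omega)]
    omega
  · rw [Sym2.eq_swap] at h
    have := hP.lt_of_mem hl (by omega) h
    rw [ord_natCast_of_lt hl (by omega)]
    omega

theorem picked_start_zero {P : Finset (Prp (m + 4))} (hP : Long P) {p : Prp (m + 4)}
    (hpe : p = s(((m + 3 : ℕ) : ZMod (m + 4)), ((m + 1 : ℕ) : ZMod (m + 4)))) (hp : p ∈ P) :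
    picked P 0 0 = some p := by
  have h0 : (0 : ZMod (m + 4)) + ((0 : ℕ) : ZMod (m + 4)) = 0 := by simp
  have hl : ((m + 3 : ℕ) : ZMod (m + 4)) = 0 - 1 := by
    rw [eq_sub_iff_add_eq, ← Nat.cast_succ]
    exact ZMod.natCast_self _
  unfold picked
  rw [pickCW_eq_some_iff, h0, remaining_zero]
  have hk : cwKey (m + 4) 0 p = (m + 4) + (m + 2) := by
    have := cwKey_of_mem_pred (0 : ZMod (m + 4)) ((m + 1 : ℕ) : ZMod (m + 4))
    rw [← hl, ord_natCast_of_lt (by omega) (by omega)] at this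
    rw [hpe, this]
    omega
  refine ⟨hp, ?_, fun q hq _ => ?_⟩
  · rw [mem_supp_iff, ← hl, hpe]
    exact Or.inl (Sym2.mem_mk_left _ _)
  · rw [hk]
    by_cases hq' : (0 : ZMod (m + 4)) - 1 ∈ q
    · obtain ⟨x, rfl⟩ := hq'
      rw [cwKey_of_mem_pred]
      rw [← hl] at hq ⊢
      have := ord_last_le hP hq
      omega
    · have := cwKey_lt_of_not_mem_pred _ _ hq'
      omega

theorem picked_start_neg_one {P : Finset (Prp (m + 4))} (hP : Long P) (hX : Planar P)
    {p : Prp (m + 4)}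
    (hpe : p = s(((m + 3 : ℕ) : ZMod (m + 4)), ((m + 1 : ℕ) : ZMod (m + 4)))) (hp : p ∈ P) :
    picked P (-1) 0 = some p := by
  have hl : (-1 : ZMod (m + 4)) + ((0 : ℕ) : ZMod (m + 4)) = ((m + 3 : ℕ) : ZMod (m + 4)) := by
    rw [Nat.cast_zero, add_zero, neg_eq_iff_add_eq_zero, add_comm (1 : ZMod (m + 4)),
      ← Nat.cast_succ]
    exact ZMod.natCast_self (m + 4)
  have hl' : ((m + 3 : ℕ) : ZMod (m + 4)) - 1 = ((m + 2 : ℕ) : ZMod (m + 4)) := by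
    push_cast
    ring
  have hnot : ∀ q ∈ P, ((m + 3 : ℕ) : ZMod (m + 4)) - 1 ∉ q := by
    intro q hq hmem
    rw [hl'] at hmem
    rcases hP.cases_of_mem (by omega) hq hmem with ⟨y, h1, h2, rfl⟩ | ⟨x, h1, rfl⟩
    · have := hP.lt_of_mem h1 h2 hq
      omega
    · have := hP.lt_of_mem h1 (by omega) hq
      rw [hpe, Sym2.eq_swap] at hp
      exact hX x (m + 2) (m + 1) (m + 3) (by omega) (by omega) (by omega) (by omega) hq hp
  unfold picked
  rw [pickCW_eq_some_iff, hl, remaining_zero]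
  have hk : cwKey (m + 4) ((m + 3 : ℕ) : ZMod (m + 4)) p = m + 2 := by
    have h := hnot p hp
    rw [hpe] at h ⊢
    rw [cwKey_of_not_mem_pred _ _ h, ord_natCast_of_lt (by omega) (by omega)]
    omega
  refine ⟨hp, ?_, fun q hq hs => ?_⟩
  · rw [mem_supp_iff, hpe]
    exact Or.inr (Sym2.mem_mk_left _ _)
  · rw [hk]
    obtain ⟨x, rfl⟩ := ((mem_supp_iff _ _).1 hs).resolve_left (hnot q hq)
    rw [cwKey_of_not_mem_pred _ _ (hnot _ hq)]
    exact ord_last_le hP hq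

theorem gnSet_subset_insert_of_picked {n : ℕ} [NeZero n] {P : Finset (Prp n)} {p : Prp n}
    {i : ZMod n} (h : picked P i 0 = some p) :
    gnSet n P i ⊆ insert i (gnSet n (P.erase p) (i + 1)) := by
  intro v hv
  obtain ⟨t, ht, rfl, hq⟩ := (mem_gnSet_iff _ _ _).1 hv
  rw [Finset.mem_insert]
  cases t with
  | zero => simp
  | succ t =>
    right
    refine (mem_gnSet_iff _ _ _).2 ⟨t, by omega, by push_cast; ring, ?_⟩
    rwa [picked_shift (remaining_succ_of_some h)] at hq

theorem gnSet_eq_insert_of_picked {n : ℕ} [NeZero n] {P : Finset (Prp n)} {p : Prp n}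
    {i : ZMod n} (h : picked P i 0 = some p) (hi : i ∉ gnSet n (P.erase p) (i + 1)) :
    gnSet n P i = insert i (gnSet n (P.erase p) (i + 1)) := by
  refine (gnSet_subset_insert_of_picked h).antisymm fun v hv => ?_
  rcases Finset.mem_insert.1 hv with rfl | hv
  · exact (mem_gnSet_iff _ _ _).2 ⟨0, Nat.pos_of_neZero n, by simp, p, h⟩
  · have hvi : v ≠ i := ne_of_mem_of_not_mem hv hi
    obtain ⟨t, ht, rfl, hq⟩ := (mem_gnSet_iff _ _ _).1 hv
    have hlt : t + 1 < n := by
      by_contra hn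
      obtain rfl : n = t + 1 := by omega
      apply hvi
      rw [add_assoc, add_comm (1 : ZMod (t + 1)), ← Nat.cast_succ, Nat.succ_eq_add_one,
        ZMod.natCast_self, add_zero]
    refine (mem_gnSet_iff _ _ _).2 ⟨t + 1, hlt, by push_cast; ring, ?_⟩
    rwa [picked_shift (remaining_succ_of_some h)]

theorem ord_lt_of_mem_gnSet {n : ℕ} [NeZero n] {P : Finset (Prp n)} {i v : ZMod n} {T : ℕ}
    (h : remaining P i T = ∅) (hv : v ∈ gnSet n P i) : ord n i v < T := by
  obtain ⟨t, ht, rfl, p, hp⟩ := (mem_gnSet_iff _ _ _).1 hv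
  have hlt : t < T := by
    by_contra hn
    rw [picked_eq_none_of_remaining_eq_empty (remaining_eq_empty_of_le h (by omega))] at hp
    simp at hp
  unfold ord
  rwa [add_sub_cancel_left, ZMod.val_cast_of_lt ht]

/-- If `p` is first met at step `T + 1`, when everything else has been deleted, then it
contributes the vertex visited in that step. -/
theorem gnSet_eq_insert_of_remaining_eq_empty {n : ℕ} [NeZero n] {P : Finset (Prp n)}
    {p : Prp n} {i : ZMod n} {T : ℕ} (hT : T < n) (hp : p ∈ P)
    (h : ∀ t < T, i + (t : ZMod n) ∉ supp n p) (hs : i + (T : ZMod n) ∈ supp n p)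
    (he : remaining (P.erase p) i T = ∅) :
    gnSet n P i = insert (i + (T : ZMod n)) (gnSet n (P.erase p) i) := by
  have key := remaining_erase_of_not_mem_supp hp h
  have hrT : remaining P i T = {p} := by rw [(key T le_rfl).1, he]; rfl
  have hpT : picked P i T = some p := by
    unfold picked
    rw [pickCW_eq_some_iff, hrT]
    refine ⟨Finset.mem_singleton_self p, hs, fun q hq _ => ?_⟩
    rw [Finset.mem_singleton.1 hq]
  have heT : remaining P i (T + 1) = ∅ := by
    rw [remaining_succ_of_some hpT, hrT, Finset.erase_singleton]
  ext v
  rw [Finset.mem_insert, mem_gnSet_iff, mem_gnSet_iff]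
  constructor
  · rintro ⟨t, ht, rfl, q, hq⟩
    rcases lt_trichotomy t T with htT | rfl | htT
    · right
      rw [(key t htT.le).2 htT] at hq
      exact ⟨t, ht, rfl, q, hq⟩
    · exact Or.inl rfl
    · rw [picked_eq_none_of_remaining_eq_empty (remaining_eq_empty_of_le heT htT)] at hq
      simp at hq
  · rintro (rfl | ⟨t, ht, rfl, q, hq⟩)
    · exact ⟨T, hT, rfl, p, hpT⟩
    · have htT : t < T := by
        by_contra hn
        rw [picked_eq_none_of_remaining_eq_empty
          (remaining_eq_empty_of_le he (by omega))] at hq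
        simp at hq
      rw [← (key t htT.le).2 htT] at hq
      exact ⟨t, ht, rfl, q, hq⟩

end Setup

section LePlus

variable {n : ℕ}

theorem lePlusAt_insert_last {A : Finset (ZMod n)} {c d : ZMod n} (hcA : c ∉ A) (hdA : d ∉ A)
    (hcd : c ≠ d) : LePlusAt n (insert c A) (insert d A) c d := by
  refine ⟨?_, ?_, ?_⟩
  · simp [hcA, hcd]
  · simp [hdA, hcd.symm]
  · rw [Finset.card_eq_zero.2, Finset.card_eq_zero.2]
    · rw [Finset.filter_eq_empty_iff]
      simp +contextual
    · rw [Finset.filter_eq_empty_iff]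
      simp +contextual

theorem lePlusAt_insert_new {A B : Finset (ZMod n)} {c d e : ZMod n}
    (hA : ∀ x ∈ A, ord n 1 x < ord n 1 c)
    (hcd : ord n 1 c < ord n 1 d) (hde : ord n 1 d < ord n 1 e) (hce : c ≠ e)
    (hB : B ⊆ insert e A) : LePlusAt n (insert c A) (insert d B) c d := by
  have hcA : c ∉ A := fun h => (hA c h).false
  have hdA : d ∉ A := fun h => absurd (hA d h) (by omega)
  have hcd' : c ≠ d := by rintro rfl; omega
  have hcB : c ∉ B := fun h => by
    rcases Finset.mem_insert.1 (hB h) with h | h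
    exacts [hce h, hcA h]
  refine ⟨by simp [hcB, hcd'], by simp [hdA, hcd'.symm], ?_⟩
  rw [Finset.card_eq_zero.2, Finset.card_eq_zero.2]
  · rw [Finset.filter_eq_empty_iff]
    intro x hx
    rw [Finset.mem_sdiff, Finset.mem_insert, Finset.mem_insert, not_or] at hx
    rcases hx.1 with rfl | h
    · omega
    · rcases Finset.mem_insert.1 (hB h) with rfl | h
      exacts [by omega, absurd h hx.2.2]
  · rw [Finset.filter_eq_empty_iff]
    intro x hx
    rw [Finset.mem_sdiff, Finset.mem_insert] at hx
    rcases hx.1 with rfl | h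
    · omega
    · have := hA x h
      omega

theorem lePlusAt_insert_of_lePlusAt {A B : Finset (ZMod n)} {a b c d e : ZMod n}
    (hA : ∀ x ∈ A, ord n 1 x < ord n 1 c)
    (hcd : ord n 1 c < ord n 1 d) (hde : ord n 1 d < ord n 1 e) (hce : c ≠ e)
    (hB : B ⊆ insert e A) (h : LePlusAt n A B a b) :
    LePlusAt n (insert c A) (insert d B) a b := by
  have hcA : c ∉ A := fun h => (hA c h).false
  have hdA : d ∉ A := fun h => absurd (hA d h) (by omega)
  have hcd' : c ≠ d := by rintro rfl; omega
  have hcB : c ∉ B := fun h => by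
    rcases Finset.mem_insert.1 (hB h) with h | h
    exacts [hce h, hcA h]
  have hdB : d ∉ B := fun h => by
    rcases Finset.mem_insert.1 (hB h) with rfl | h
    exacts [hde.false, hdA h]
  obtain ⟨h1, h2, h3⟩ := h
  have h2' := Finset.mem_sdiff.1 h2
  have h1' := Finset.mem_sdiff.1 h1
  obtain rfl : b = e := (Finset.mem_insert.1 (hB h2'.1)).resolve_right h2'.2
  have e1 : insert c A \ insert d B = insert c (A \ B) := by
    ext x
    simp only [Finset.mem_sdiff, Finset.mem_insert]
    constructor
    · tauto
    · rintro (rfl | ⟨hx, hx'⟩)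
      · tauto
      · have : x ≠ d := by rintro rfl; exact hdA hx
        tauto
  have e2 : insert d B \ insert c A = insert d (B \ A) := by
    ext x
    simp only [Finset.mem_sdiff, Finset.mem_insert]
    constructor
    · tauto
    · rintro (rfl | ⟨hx, hx'⟩)
      · have := hcd'.symm
        tauto
      · have : x ≠ c := by rintro rfl; exact hcB hx
        tauto
  unfold LePlusAt
  rw [e1, e2, Finset.filter_insert, Finset.filter_insert, if_pos (hA a h1'.1), if_pos hde,
    Finset.card_insert_of_notMem, Finset.card_insert_of_notMem, h3]
  · exact ⟨Finset.mem_insert_of_mem h1, Finset.mem_insert_of_mem h2, rfl⟩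
  · simp [hdB]
  · simp [hcA]

end LePlus

/-- plusses from the terms `I_n^W` and `I_{n-1}^W`.
Under the Setup, in the construction of the Le diagram of `W` the necklace term
`I_n^W` contributes a `+` in the `(n-3) → n` position, and the necklace term
`I_{n-1}^W` contributes a `+` in the `(n-3) → (n-1)` position together with all
of the plusses contributed by the term `I_n^V` in the Le diagram of `V`. -/
theorem lePlus_of_terms_n_and_n_sub_one
    (n : ℕ) [NeZero n] (P : Finset (Prp n))
    (hadm : IsAdmissible n P) (hne : P.Nonempty)
    (hp : (s(-3, -1) : Prp n) ∈ P)
    (hlen : plength n (s(-3, -1) : Prp n) = 2)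
    (hin : ∀ r ∈ P, InsideDir n (-3) (s(-3, -1) : Prp n) r → r = (s(-3, -1) : Prp n))
    (hedge : (∀ r ∈ P, (-3 : ZMod n) ∈ r → r = (s(-3, -1) : Prp n)) ∨
      ((s(-5, -3) : Prp n) ∈ P ∧ plength n (s(-5, -3) : Prp n) = 2 ∧
        (∀ r ∈ P, (-3 : ZMod n) ∈ r →
          r = (s(-3, -1) : Prp n) ∨ r = (s(-5, -3) : Prp n)) ∧
        (∀ r ∈ P, InsideDir n (-5) (s(-5, -3) : Prp n) r → r = (s(-5, -3) : Prp n))))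
    :
    LePlusAt n (gnSet n P 1) (gnSet n P 0) (-3) 0 ∧
    LePlusAt n (gnSet n P 1) (gnSet n P (-1)) (-3) (-1) ∧
    ∀ a b : ZMod n,
      LePlusAt n (gnSet n (eraseP n P) 1) (gnSet n (eraseP n P) 0) a b →
        LePlusAt n (gnSet n P 1) (gnSet n P (-1)) a b := by
  have hP := hadm.long
  have hX := hadm.planar
  have hcard := Finset.card_pos.2 hne
  obtain ⟨m, rfl⟩ : ∃ m, n = m + 4 := ⟨n - 4, by have := hadm.card_add_four_le; omega⟩
  have hm : 1 ≤ m := by have := hadm.card_add_four_le; omega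
  have e1 : (-1 : ZMod (m + 4)) = ((m + 3 : ℕ) : ZMod (m + 4)) := by
    simpa using neg_natCast_eq (n := m + 4) (k := 1) (by omega)
  have e3 : (-3 : ZMod (m + 4)) = ((m + 1 : ℕ) : ZMod (m + 4)) := by
    simpa using neg_natCast_eq (n := m + 4) (k := 3) (by omega)
  have e5 : (-5 : ZMod (m + 4)) = ((m - 1 : ℕ) : ZMod (m + 4)) := by
    simpa using neg_natCast_eq (n := m + 4) (k := 5) (by omega)
  have eT : (1 : ZMod (m + 4)) + ((m : ℕ) : ZMod (m + 4)) = -3 := by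
    rw [e3]
    push_cast
    ring
  have hpe : (s(-3, -1) : Prp (m + 4)) =
      s(((m + 1 : ℕ) : ZMod (m + 4)), ((m + 3 : ℕ) : ZMod (m + 4))) := by rw [e1, e3]
  have hpe' : (s(-3, -1) : Prp (m + 4)) =
      s(((m + 3 : ℕ) : ZMod (m + 4)), ((m + 1 : ℕ) : ZMod (m + 4))) := by
    rw [hpe, Sym2.eq_swap]
  have hempty : remaining (P.erase s(-3, -1)) 1 m = ∅ := by
    refine remaining_erase_eq_empty hP hX hpe hp fun r hr hmem => ?_
    rw [← e3] at hmem ⊢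
    rcases hedge with h | ⟨-, -, h, -⟩
    · exact Or.inl (h r hr hmem)
    · refine (h r hr hmem).imp_right fun hq => ⟨m - 1, by omega, ?_⟩
      rw [hq, e5]
  have o1 : ord (m + 4) 1 (-1) = m + 2 := by
    simpa [e1] using ord_natCast_of_le (n := m + 4) (a := 1) (b := m + 3) (by omega) (by omega)
  have o3 : ord (m + 4) 1 (-3) = m := by
    simpa [e3] using ord_natCast_of_le (n := m + 4) (a := 1) (b := m + 1) (by omega) (by omega)
  have o0 : ord (m + 4) 1 0 = m + 3 := by
    simpa using ord_natCast_of_lt (n := m + 4) (a := 1) (b := 0) (by omega) (by omega)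
  have hI1 : gnSet (m + 4) P 1 = insert (-3) (gnSet (m + 4) (P.erase s(-3, -1)) 1) := by
    have h := gnSet_eq_insert_of_remaining_eq_empty (by omega) hp (fun t ht => ?_) ?_ hempty
    · rwa [eT] at h
    · have hv : (1 : ZMod (m + 4)) + (t : ZMod (m + 4)) = ((t + 1 : ℕ) : ZMod (m + 4)) := by
        push_cast
        ring
      have hv' : ((t + 1 : ℕ) : ZMod (m + 4)) - 1 = (t : ZMod (m + 4)) := by simp
      rw [hv, mem_supp_iff, hv', hpe, not_or]
      exact ⟨natCast_not_mem (by omega) (by omega) (by omega) (by omega) (by omega),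
        natCast_not_mem (by omega) (by omega) (by omega) (by omega) (by omega)⟩
    · rw [eT]
      simp [supp]
  set A := gnSet (m + 4) (P.erase s(-3, -1)) 1
  have hAm : ∀ x ∈ A, ord (m + 4) 1 x < m := fun x hx => ord_lt_of_mem_gnSet hempty hx
  have h0A : (0 : ZMod (m + 4)) ∉ A := fun h => by have := hAm _ h; omega
  have h1A : (-1 : ZMod (m + 4)) ∉ A := fun h => by have := hAm _ h; omega
  have h3A : (-3 : ZMod (m + 4)) ∉ A := fun h => by have := hAm _ h; omega
  have n30 : (-3 : ZMod (m + 4)) ≠ 0 := fun h => by rw [h] at o3; omega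
  have n10 : (-1 : ZMod (m + 4)) ≠ 0 := fun h => by rw [h] at o1; omega
  have hI0 : gnSet (m + 4) P 0 = insert 0 A := by
    have := gnSet_eq_insert_of_picked (picked_start_zero hP hpe' hp)
    rw [zero_add] at this
    exact this h0A
  have hB : gnSet (m + 4) (P.erase s(-3, -1)) 0 ⊆ insert 0 A := by
    have := gnSet_subset_insert (P.erase s(-3, -1)) (0 : ZMod (m + 4))
    rwa [zero_add] at this
  have hIneg : gnSet (m + 4) P (-1) =
      insert (-1) (gnSet (m + 4) (P.erase s(-3, -1)) 0) := by
    have := gnSet_eq_insert_of_picked (picked_start_neg_one hP hX hpe' hp)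
    rw [neg_add_cancel] at this
    refine this fun h => ?_
    rcases Finset.mem_insert.1 (hB h) with h | h
    exacts [n10 h, h1A h]
  rw [hI1, hI0, hIneg]
  have hA3 : ∀ x ∈ A, ord (m + 4) 1 x < ord (m + 4) 1 (-3) := by
    intro x hx
    rw [o3]
    exact hAm x hx
  have h31 : ord (m + 4) 1 (-3) < ord (m + 4) 1 (-1) := by rw [o3, o1]; omega
  have h10 : ord (m + 4) 1 (-1) < ord (m + 4) 1 0 := by rw [o1, o0]; omega
  exact ⟨lePlusAt_insert_last h3A h0A n30, lePlusAt_insert_new hA3 h31 h10 n30 hB,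
    fun a b h => lePlusAt_insert_of_lePlusAt hA3 h31 h10 n30 hB h⟩

end WLD
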